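/- arXiv:2101.02133 — 2 statements merged into one kernel-verified Lean document; each statement's English description precedes it below -/
import Mathlib

section
/- Let 𝒜^V denote the subalgebra of bounded operators on H_n generated by {T^V(σ) : σ a permutation of {1,…,n}} ∪ {D^V(Φ) : Φ : S^n → ℂ bounded}. Then for every A ∈ 𝒜^V, every permutation λ of {1,…,n}, and every bounded Ψ : S^n → ℂ, ⟨A ∘ T^W(λ) ∘ D^W(Ψ) Ξ, Ξ⟩ = ⟨D^V(Ψ) ∘ T^V(λ^{-1}) ∘ A Ξ, Ξ⟩. -/
noncomputable section

/-- The set of nonzero integers. -/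
abbrev Sz : Type := {i : ℤ // i ≠ 0}

/-- The Hilbert space `ℓ²(S^n × S^n; ℂ)`. -/
abbrev HVW (n : ℕ) : Type := lp (fun _ : (Fin n → Sz) × (Fin n → Sz) => ℂ) 2

/-- Canonical orthonormal basis vectors `e_{I,J}`. -/
def eVW {n : ℕ} (I J : Fin n → Sz) : HVW n := lp.single 2 (I, J) (1 : ℂ)

/-- The unit vector `Ξ = ∑_I (∏_k a(I_k))^{1/2} e_{I,I}`. -/
def Xi (n : ℕ) (a : Sz → ℝ) : HVW n :=
  ∑' I : Fin n → Sz, (Real.sqrt (∏ k, a (I k)) : ℂ) • eVW I I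

/-- The coordinates of `Ξ`, when its defining series converges. -/
theorem Xi_apply {n : ℕ} {a : Sz → ℝ}
    (h : Summable fun I : Fin n → Sz => (Real.sqrt (∏ k, a (I k)) : ℂ) • eVW I I)
    (I J : Fin n → Sz) :
    Xi n a (I, J) = if I = J then (Real.sqrt (∏ k, a (I k)) : ℂ) else 0 := by
  have hs := h.hasSum.mapL (lp.evalCLM ℂ (fun _ : (Fin n → Sz) × (Fin n → Sz) => ℂ) 2 (I, J))
  rw [← Xi] at hs
  refine hs.unique ?_
  have hterm : (fun K => lp.evalCLM ℂ (fun _ : (Fin n → Sz) × (Fin n → Sz) => ℂ) 2 (I, J)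
      ((Real.sqrt (∏ k, a (K k)) : ℂ) • eVW K K)) =
      fun K => if K = I then (if I = J then (Real.sqrt (∏ k, a (I k)) : ℂ) else 0) else 0 := by
    funext K
    change (Real.sqrt (∏ k, a (K k)) : ℂ) * (eVW K K : HVW n) (I, J) = _
    rw [eVW, lp.single_apply, Pi.single_apply]
    grind
  rw [hterm]
  exact hasSum_ite_eq I _

/-- `Ξ` is supported on the diagonal. -/
theorem Xi_apply_of_ne {n : ℕ} (a : Sz → ℝ) {I J : Fin n → Sz} (hIJ : I ≠ J) :
    Xi n a (I, J) = 0 := by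
  by_cases h : Summable fun I : Fin n → Sz => (Real.sqrt (∏ k, a (I k)) : ℂ) • eVW I I
  · rw [Xi_apply h, if_neg hIJ]
  · rw [Xi, tsum_eq_zero_of_not_summable h]
    rfl

/-- `Ξ` is invariant under simultaneous permutation of both multi-indices. -/
theorem Xi_comp_perm {n : ℕ} (a : Sz → ℝ) (σ : Equiv.Perm (Fin n)) (I J : Fin n → Sz) :
    Xi n a (I ∘ σ, J ∘ σ) = Xi n a (I, J) := by
  by_cases h : Summable fun I : Fin n → Sz => (Real.sqrt (∏ k, a (I k)) : ℂ) • eVW I I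
  · simp only [Xi_apply h, σ.surjective.injective_comp_right.eq_iff, Function.comp_apply,
      Equiv.prod_comp σ fun k => a (I k)]
  · rw [Xi, tsum_eq_zero_of_not_summable h]
    rfl

/-!
STATEMENT 10: For every `A` in the subalgebra `𝒜^V` generated by the `T^V(σ)` and the
`D^V(Φ)` (Φ bounded), every permutation λ and every bounded Ψ,
`⟨A ∘ T^W(λ) ∘ D^W(Ψ) Ξ, Ξ⟩ = ⟨D^V(Ψ) ∘ T^V(λ⁻¹) ∘ A Ξ, Ξ⟩`.
(Mathlib's inner product is conjugate-linear in the first variable, so the paper's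
`⟨A Ξ, Ξ⟩` is rendered as `inner Ξ (A Ξ)`.)
-/

theorem trace_moves_W_operator_to_transposed_V_operator (n : ℕ) (a : Sz → ℝ)
    (ha : ∀ i, 0 ≤ a i) (hsum : HasSum a 1)
    (T : Equiv.Perm (Fin n) → (HVW n →L[ℂ] HVW n))
    (hT : ∀ (σ : Equiv.Perm (Fin n)) (f : HVW n) (I J : Fin n → Sz),
      (T σ f) (I, J) = f (I ∘ σ, J))
    (D : ((Fin n → Sz) → ℂ) → (HVW n →L[ℂ] HVW n))
    (hD : ∀ Φ : (Fin n → Sz) → ℂ, (∃ C : ℝ, ∀ I, ‖Φ I‖ ≤ C) →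
      ∀ (f : HVW n) (I J : Fin n → Sz), (D Φ f) (I, J) = Φ I * f (I, J))
    (lam : Equiv.Perm (Fin n)) (Ψ : (Fin n → Sz) → ℂ)
    (hΨ : ∃ C : ℝ, ∀ I, ‖Ψ I‖ ≤ C)
    (TW DW : HVW n →L[ℂ] HVW n)
    (hTW : ∀ (f : HVW n) (I J : Fin n → Sz), (TW f) (I, J) = f (I, J ∘ lam))
    (hDW : ∀ (f : HVW n) (I J : Fin n → Sz), (DW f) (I, J) = Ψ J * f (I, J))
    (A : HVW n →L[ℂ] HVW n)
    (hA : A ∈ Algebra.adjoin ℂ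
      (Set.range T ∪ D '' {Φ | ∃ C : ℝ, ∀ I, ‖Φ I‖ ≤ C})) :
    (inner ℂ (Xi n a) (A (TW (DW (Xi n a)))) : ℂ) =
      inner ℂ (Xi n a) (D Ψ (T lam⁻¹ (A (Xi n a)))) := by
  set Ξ := Xi n a
  have hcomm : ∀ f, A (TW (DW f)) = TW (DW (A f)) := by
    have hmem : TW * DW ∈ Subalgebra.centralizer ℂ
        (Set.range T ∪ D '' {Φ | ∃ C : ℝ, ∀ I, ‖Φ I‖ ≤ C}) := by
      rw [Subalgebra.mem_centralizer_iff]
      rintro _ (⟨σ, rfl⟩ | ⟨Φ, hΦ, rfl⟩)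
      · ext f ⟨I, J⟩
        simp only [mul_apply_eq_comp, hT, hTW, hDW]
      · ext f ⟨I, J⟩
        simp only [mul_apply_eq_comp, hD Φ hΦ, hTW, hDW]
        ring
    exact fun f => (DFunLike.congr_fun
      (Algebra.adjoin_le_centralizer_centralizer ℂ _ hA (TW * DW) hmem) f).symm
  rw [hcomm, lp.inner_eq_tsum, lp.inner_eq_tsum]
  let e := Equiv.arrowCongr lam (Equiv.refl Sz)
  rw [← (Equiv.prodCongr e e).tsum_eq]
  refine tsum_congr ?_
  rintro ⟨I, J⟩
  have hJ : (J ∘ ⇑lam⁻¹) ∘ ⇑lam = J := by ext; simp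
  change inner ℂ (Ξ (I ∘ ⇑lam⁻¹, J ∘ ⇑lam⁻¹)) (TW (DW (A Ξ)) (I ∘ ⇑lam⁻¹, J ∘ ⇑lam⁻¹)) = _
  rw [hTW, hDW, hD Ψ hΨ, hT, Xi_comp_perm, hJ]
  by_cases hIJ : I = J
  · rw [hIJ]
  · rw [Xi_apply_of_ne a hIJ, inner_zero_left, inner_zero_left]
end
end

section
/- Let q = 1 and assume ∑_j α_j + ∑_i β_i = 1. Then for 1 ≤ m ≤ n, ⟨R^{left}_{m−1} ∘ ⋯ ∘ R^{left}_1 Ξ, Ξ⟩ = ∑_{j≥1} α_j^m + (−1)^{m−1} ∑_{i≥1} β_i^m = p_m(α,β); this is the Thoma character value of the infinite symmetric group on an m-cycle. -/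
noncomputable section

/-- The tuple `I` with its entries at positions `p` and `p'` interchanged. -/
def swapAt {n : ℕ} (I : Fin n → Sz) (p p' : Fin n) : Fin n → Sz :=
  Function.update (Function.update I p (I p')) p' (I p)

/-- The diagonal coefficient `c_q(i,j)`: `−1` if `i = j < 0`, `q` if `i = j > 0`,
`q − 1` if `i < j`, and `0` if `i > j`. -/
def cq (q : ℝ) (i j : Sz) : ℝ :=
  if (i : ℤ) = (j : ℤ) then (if (i : ℤ) < 0 then -1 else q)
  else if (i : ℤ) < (j : ℤ) then q - 1 else 0

/-- `R` acts on basis vectors `e_{I,J}` by the Kerov R-matrix rules applied to the pair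
`(I_k, I_{k+1})` (0-based positions `k`, `k+1`), leaving the other entries of `I` and all
of `J` unchanged. -/
def KerovRuleVW (n : ℕ) (q : ℝ) (k : ℕ) (hk : k + 1 < n)
    (R : HVW n →L[ℂ] HVW n) : Prop :=
  ∀ I J : Fin n → Sz,
    ((I ⟨k, Nat.lt_of_succ_lt hk⟩ : ℤ) = (I ⟨k + 1, hk⟩ : ℤ) →
      (((I ⟨k, Nat.lt_of_succ_lt hk⟩ : ℤ) < 0 → R (eVW I J) = - eVW I J) ∧
       (0 < (I ⟨k, Nat.lt_of_succ_lt hk⟩ : ℤ) → R (eVW I J) = (q : ℂ) • eVW I J))) ∧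
    ((I ⟨k + 1, hk⟩ : ℤ) < (I ⟨k, Nat.lt_of_succ_lt hk⟩ : ℤ) →
      R (eVW I J) = -((Real.sqrt q : ℂ) •
        eVW (swapAt I ⟨k, Nat.lt_of_succ_lt hk⟩ ⟨k + 1, hk⟩) J)) ∧
    ((I ⟨k, Nat.lt_of_succ_lt hk⟩ : ℤ) < (I ⟨k + 1, hk⟩ : ℤ) →
      R (eVW I J) = -((Real.sqrt q : ℂ) •
        eVW (swapAt I ⟨k, Nat.lt_of_succ_lt hk⟩ ⟨k + 1, hk⟩) J) + ((q : ℂ) - 1) • eVW I J)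

/-- `opChain F j = F (j-1) ∘ ⋯ ∘ F 1 ∘ F 0` (and the identity for `j = 0`). -/
def opChain {n : ℕ} (F : ℕ → (HVW n →L[ℂ] HVW n)) : ℕ → (HVW n →L[ℂ] HVW n)
  | 0 => 1
  | j + 1 => F j * opChain F j

/-- The weights `a : S → ℝ`: `a(j) = α_j` for `j > 0` and `a(−i) = β_i` for `i > 0`
(with `α`, `β` indexed by `ℕ`, index `j` standing for the paper's `j+1`). -/
def aOf (α β : ℕ → ℝ) (i : Sz) : ℝ :=
  if 0 < (i : ℤ) then α ((i : ℤ).toNat - 1) else β ((-(i : ℤ)).toNat - 1)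

/-- The scalar by which the Kerov R-matrix at `q = 1` multiplies the flipped pair `(j, i)`. -/
def kerovSign (i j : Sz) : ℝ := if i = j ∧ 0 < (i : ℤ) then 1 else -1

lemma kerovRule_one_apply {n k : ℕ} {hk : k + 1 < n} {R : HVW n →L[ℂ] HVW n}
    (h : KerovRuleVW n 1 k hk R) (I J : Fin n → Sz) :
    R (eVW I J) = (kerovSign (I ⟨k, Nat.lt_of_succ_lt hk⟩) (I ⟨k + 1, hk⟩) : ℂ) •
      eVW (swapAt I ⟨k, Nat.lt_of_succ_lt hk⟩ ⟨k + 1, hk⟩) J := by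
  obtain ⟨h₁, h₂, h₃⟩ := h I J
  rcases lt_trichotomy (I ⟨k, Nat.lt_of_succ_lt hk⟩ : ℤ) (I ⟨k + 1, hk⟩ : ℤ) with hlt | heq | hgt
  · have hne : I ⟨k, Nat.lt_of_succ_lt hk⟩ ≠ I ⟨k + 1, hk⟩ := fun e => hlt.ne (congrArg _ e)
    simp [h₃ hlt, kerovSign, hne]
  · have he : I ⟨k, Nat.lt_of_succ_lt hk⟩ = I ⟨k + 1, hk⟩ := Subtype.ext heq
    have hs : swapAt I ⟨k, Nat.lt_of_succ_lt hk⟩ ⟨k + 1, hk⟩ = I := by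
      rw [swapAt, ← he, Function.update_eq_self, he, Function.update_eq_self]
    rw [hs]
    rcases lt_or_gt_of_ne (I ⟨k, Nat.lt_of_succ_lt hk⟩).2 with hneg | hpos
    · simp [(h₁ heq).1 hneg, kerovSign, not_lt.2 hneg.le]
    · have hpos' := hpos
      rw [he] at hpos'
      simp [(h₁ heq).2 hpos, kerovSign, he, hpos']
  · have hne : I ⟨k, Nat.lt_of_succ_lt hk⟩ ≠ I ⟨k + 1, hk⟩ := fun e => hgt.ne' (congrArg _ e)
    simp [h₂ hgt, kerovSign, hne]

/-- The tuple `(I₁, …, I_j, I₀, I_{j+1}, …)`. -/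
def cycleTuple {n : ℕ} (j : ℕ) (hj : j < n) (I : Fin n → Sz) : Fin n → Sz := fun k =>
  if h : (k : ℕ) < j then I ⟨k + 1, by omega⟩
  else if (k : ℕ) = j then I ⟨0, by omega⟩ else I k

lemma swapAt_cycleTuple {n j : ℕ} (hj : j + 1 < n) (I : Fin n → Sz) :
    swapAt (cycleTuple j (Nat.lt_of_succ_lt hj) I) ⟨j, Nat.lt_of_succ_lt hj⟩ ⟨j + 1, hj⟩ =
      cycleTuple (j + 1) hj I := by
  funext k
  rcases lt_trichotomy (k : ℕ) j with h | h | h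
  · have h₁ : k ≠ ⟨j, Nat.lt_of_succ_lt hj⟩ := fun e => by simp [e] at h
    have h₂ : k ≠ ⟨j + 1, hj⟩ := fun e => by simp [e] at h
    simp [swapAt, cycleTuple, Function.update_of_ne, h₁, h₂, h, Nat.lt_succ_of_lt h]
  · obtain rfl : k = ⟨j, Nat.lt_of_succ_lt hj⟩ := Fin.ext h
    simp [swapAt, cycleTuple]
  · by_cases h' : (k : ℕ) = j + 1
    · obtain rfl : k = ⟨j + 1, hj⟩ := Fin.ext h'
      simp [swapAt, cycleTuple]
    · have h₁ : k ≠ ⟨j, Nat.lt_of_succ_lt hj⟩ := fun e => by simp [e] at h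
      have h₂ : k ≠ ⟨j + 1, hj⟩ := fun e => h' (by simp [e])
      have h₃ : ¬ (k : ℕ) < j := by omega
      have h₄ : ¬ (k : ℕ) < j + 1 := by omega
      simp [swapAt, cycleTuple, Function.update_of_ne, h₁, h₂, h₃, h₄, h', h.ne']

lemma opChain_apply_eVW {n : ℕ} {Rl : ℕ → (HVW n →L[ℂ] HVW n)}
    (hR : ∀ k (hk : k + 1 < n), KerovRuleVW n 1 k hk (Rl k)) (j : ℕ) (hj : j < n)
    (I J : Fin n → Sz) :
    opChain Rl j (eVW I J) =
      ((∏ k : Fin j, kerovSign (I ⟨0, by omega⟩) (I ⟨k + 1, by omega⟩) : ℝ) : ℂ) •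
        eVW (cycleTuple j hj I) J := by
  induction j with
  | zero =>
    have : cycleTuple 0 hj I = I := by
      funext k
      by_cases h : (k : ℕ) = 0
      · obtain rfl : k = ⟨0, hj⟩ := Fin.ext h
        simp [cycleTuple]
      · simp [cycleTuple, h]
    simp [opChain, this]
  | succ j ih =>
    rw [opChain, mul_apply_eq_comp, ih (by omega), map_smul, kerovRule_one_apply (hR j hj),
      swapAt_cycleTuple, smul_smul, Fin.prod_univ_castSucc]
    simp [cycleTuple]

lemma cycleTuple_eq_self_iff {n j : ℕ} (hj : j < n) (I : Fin n → Sz) :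
    cycleTuple j hj I = I ↔ ∀ k : Fin n, (k : ℕ) ≤ j → I k = I ⟨0, by omega⟩ := by
  constructor
  · intro h k
    obtain ⟨k, hk⟩ := k
    intro hkj
    induction k with
    | zero => rfl
    | succ k ih =>
      rw [← ih (by omega) (by simp at hkj ⊢; omega)]
      have := congrFun h ⟨k, by omega⟩
      have hlt : k < j := hkj
      simpa [cycleTuple, hlt] using this
  · intro h
    funext k
    rcases lt_trichotomy (k : ℕ) j with hk | hk | hk
    · simp [cycleTuple, hk, h k hk.le, h ⟨k + 1, by omega⟩ hk]
    · simp [cycleTuple, hk, h k hk.le]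
    · simp [cycleTuple, hk.not_gt, hk.ne']

lemma hasSum_mul_real {ι κ : Type*} {f : ι → ℝ} {g : κ → ℝ} {s t : ℝ} (hf : HasSum f s)
    (hg : HasSum g t) : HasSum (fun p : ι × κ => f p.1 * g p.2) (s * t) :=
  hf.mul hg (summable_mul_of_summable_norm hf.summable.norm hg.summable.norm)

lemma hasSum_pi_prod {S : Type*} {a : S → ℝ} (hs : HasSum a 1) (n : ℕ) :
    HasSum (fun I : Fin n → S => ∏ k, a (I k)) 1 := by
  induction n with
  | zero => simp
  | succ n ih =>
    rw [← (Fin.consEquiv fun _ => S).hasSum_iff]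
    have h := hasSum_mul_real hs ih
    simpa [Function.comp_def, Fin.consEquiv, Fin.prod_univ_succ] using h

/-- `Ξ` as a square-summable function. -/
lemma xi_hasSum {n : ℕ} {a : Sz → ℝ} (ha : ∀ i, 0 ≤ a i) (hs : HasSum a 1) :
    HasSum (fun I : Fin n → Sz => (Real.sqrt (∏ k, a (I k)) : ℂ) • eVW I I) (Xi n a) ∧
    ∀ I J, Xi n a (I, J) = if I = J then (Real.sqrt (∏ k, a (I k)) : ℂ) else 0 := by
  have hinj : Function.Injective (fun I : Fin n → Sz => (I, I)) := fun I J h => congrArg Prod.fst h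
  let f : (Fin n → Sz) × (Fin n → Sz) → ℂ :=
    fun p => if p.1 = p.2 then (Real.sqrt (∏ k, a (p.1 k)) : ℂ) else 0
  have hf0 : ∀ p ∉ Set.range (fun I : Fin n → Sz => (I, I)), f p = 0 := by
    rintro ⟨I, J⟩ h
    refine if_neg ?_
    rintro (rfl : I = J)
    exact h ⟨I, rfl⟩
  have hf : Memℓp f 2 := by
    apply memℓp_gen
    rw [← hinj.summable_iff fun p hp => by simp [hf0 p hp]]
    refine (hasSum_pi_prod hs n).summable.congr fun I => ?_
    have : 0 ≤ ∏ k, a (I k) := Finset.prod_nonneg fun k _ => ha _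
    simp [f, Real.sq_sqrt this]
  let F : HVW n := ⟨f, hf⟩
  have h := lp.hasSum_single (by simp) F
  rw [← hinj.hasSum_iff fun p hp => by simp [F, hf0 p hp]] at h
  have hsum : HasSum (fun I : Fin n → Sz => (Real.sqrt (∏ k, a (I k)) : ℂ) • eVW I I) F := by
    convert h using 2 with I
    simp [eVW, ← lp.single_smul, F, f]
  have hXi : Xi n a = F := hsum.tsum_eq
  rw [hXi]
  exact ⟨hsum, fun I J => rfl⟩

lemma inner_xi_opChain_hasSum {n : ℕ} {a : Sz → ℝ} (ha : ∀ i, 0 ≤ a i) (hs : HasSum a 1)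
    {Rl : ℕ → (HVW n →L[ℂ] HVW n)}
    (hR : ∀ k (hk : k + 1 < n), KerovRuleVW n 1 k hk (Rl k)) (j : ℕ) (hj : j < n) :
    HasSum (fun I : Fin n → Sz => ((if cycleTuple j hj I = I then
        kerovSign (I ⟨0, by omega⟩) (I ⟨0, by omega⟩) ^ j * ∏ k, a (I k) else 0 : ℝ) : ℂ))
      (inner ℂ (Xi n a) (opChain Rl j (Xi n a))) := by
  obtain ⟨hsum, hXi⟩ := xi_hasSum (n := n) ha hs
  have h := hsum.mapL ((innerSL ℂ (Xi n a)).comp (opChain Rl j))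
  refine (congrArg (fun F => HasSum F _) (funext fun I => ?_)).mpr h
  have hp : 0 ≤ ∏ k, a (I k) := Finset.prod_nonneg fun k _ => ha _
  rw [map_smul, ContinuousLinearMap.comp_apply, opChain_apply_eVW hR j hj, map_smul,
    innerSL_apply_apply, eVW, lp.inner_single_right, hXi]
  by_cases hc : cycleTuple j hj I = I
  · have hI := (cycleTuple_eq_self_iff hj I).1 hc
    have hprod : ∏ k : Fin j, kerovSign (I ⟨0, by omega⟩) (I ⟨k + 1, by omega⟩) =
        kerovSign (I ⟨0, by omega⟩) (I ⟨0, by omega⟩) ^ j := by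
      rw [Finset.prod_congr rfl fun k _ => by rw [hI ⟨k + 1, by omega⟩ (by simp)]]
      simp
    rw [if_pos hc, if_pos hc, hc, hprod]
    nth_rewrite 1 [← Real.mul_self_sqrt hp]
    simp
    ring
  · simp [hc]

lemma hasSum_cycleTuple_fixed {a : Sz → ℝ} (hs : HasSum a 1) (j r : ℕ)
    {s : ℝ} (h : HasSum (fun i => kerovSign i i ^ j * a i ^ (j + 1)) s) :
    HasSum (fun I : Fin (j + 1 + r) → Sz => if cycleTuple j (by omega) I = I then
        kerovSign (I ⟨0, by omega⟩) (I ⟨0, by omega⟩) ^ j * ∏ k, a (I k) else 0) s := by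
  let g : Sz × (Fin r → Sz) → (Fin (j + 1 + r) → Sz) :=
    fun p => Fin.append (fun _ : Fin (j + 1) => p.1) p.2
  have g_left : ∀ p (k : Fin (j + 1 + r)), (k : ℕ) ≤ j → g p k = p.1 := fun p k hk =>
    Fin.append_left (fun _ : Fin (j + 1) => p.1) p.2 ⟨k, by omega⟩
  have hg : Function.Injective g := by
    rintro ⟨i, K⟩ ⟨i', K'⟩ h
    refine Prod.ext ?_ (funext fun k => ?_)
    · have h0 := congrFun h ⟨0, by omega⟩
      rwa [g_left _ _ (Nat.zero_le j), g_left _ _ (Nat.zero_le j)] at h0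
    · simpa [g] using congrFun h (Fin.natAdd (j + 1) k)
  rw [← hg.hasSum_iff]
  · have hP := hasSum_pi_prod hs r
    have hmul := hasSum_mul_real h hP
    rw [mul_one] at hmul
    refine (congrArg (fun F => HasSum F _) (funext fun p => ?_)).mpr hmul
    have hc : cycleTuple j (by omega) (g p) = g p := by
      rw [cycleTuple_eq_self_iff]
      intro k hk
      rw [g_left p k hk, g_left p _ (by simp)]
    rw [Function.comp_apply, if_pos hc, g_left p _ (by simp), Fin.prod_univ_add]
    simp [g]
    ring
  · intro I hI
    refine if_neg fun hc => hI ⟨(I ⟨0, by omega⟩, fun k => I (Fin.natAdd (j + 1) k)), ?_⟩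
    rw [cycleTuple_eq_self_iff] at hc
    funext k
    refine Fin.addCases (fun k => ?_) (fun k => ?_) k
    · rw [g_left _ _ (by simp; omega), hc (Fin.castAdd r k) (by simp; omega)]
    · simp [g]

/-- The nonzero integers as two copies of `ℕ`. -/
def natSumNatEquivSz : ℕ ⊕ ℕ ≃ Sz where
  toFun := Sum.elim (fun n => ⟨n + 1, by omega⟩) (fun n => ⟨-(n + 1), by omega⟩)
  invFun i := if 0 < (i : ℤ) then .inl ((i : ℤ).toNat - 1) else .inr ((-(i : ℤ)).toNat - 1)
  left_inv := by
    rintro (n | n)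
    · have : (0 : ℤ) < n + 1 := by omega
      simp [this]
    · have : ¬ (0 : ℤ) < -(n + 1) := by omega
      simp only [Sum.elim_inr, this, if_false]
      simp
  right_inv := by
    rintro ⟨i, hi⟩
    by_cases h : 0 < i
    · simp only [h, if_true, Sum.elim_inl, Subtype.mk.injEq]
      omega
    · simp only [h, if_false, Sum.elim_inr, Subtype.mk.injEq]
      omega

lemma aOf_inl (α β : ℕ → ℝ) (n : ℕ) : aOf α β (natSumNatEquivSz (.inl n)) = α n := by
  have : (0 : ℤ) < n + 1 := by omega
  simp [aOf, natSumNatEquivSz, this]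

lemma aOf_inr (α β : ℕ → ℝ) (n : ℕ) : aOf α β (natSumNatEquivSz (.inr n)) = β n := by
  have h : ¬ (0 : ℤ) < -(n + 1) := by omega
  simp only [aOf, natSumNatEquivSz, Equiv.coe_fn_mk, Sum.elim_inr, h, if_false]
  simp

lemma kerovSign_inl (n : ℕ) :
    kerovSign (natSumNatEquivSz (.inl n)) (natSumNatEquivSz (.inl n)) = 1 := by
  have : (0 : ℤ) < n + 1 := by omega
  simp [kerovSign, natSumNatEquivSz, this]

lemma kerovSign_inr (n : ℕ) :
    kerovSign (natSumNatEquivSz (.inr n)) (natSumNatEquivSz (.inr n)) = -1 := by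
  have h : ¬ (0 : ℤ) < -(n + 1) := by omega
  simp only [kerovSign, natSumNatEquivSz, Equiv.coe_fn_mk, Sum.elim_inr, h, and_false, if_false]

lemma summable_pow_of_tsum_le_one {f : ℕ → ℝ} (hf : ∀ i, 0 ≤ f i) (hs : Summable f)
    (h : ∑' i, f i ≤ 1) (j : ℕ) : Summable fun i => f i ^ (j + 1) :=
  hs.of_nonneg_of_le (fun i => pow_nonneg (hf i) _) fun i =>
    pow_le_of_le_one (hf i) ((hs.le_tsum i fun k _ => hf k).trans h) (by omega)

/-!
STATEMENT 19: At `q = 1`, for `1 ≤ m ≤ n`,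
`⟨R^{left}_{m−1} ∘ ⋯ ∘ R^{left}_1 Ξ, Ξ⟩ = ∑_j α_j^m + (−1)^{m−1} ∑_i β_i^m = p_m(α,β)`,
the Thoma character value of the infinite symmetric group on an `m`-cycle.
(At `q = 1` the Kerov rules specialize to `(i,i) ↦ −(i,i)` for `i < 0`, `(i,i) ↦ (i,i)`
for `i > 0`, `(i,j) ↦ −(j,i)` for `i ≠ j`, which is `KerovRuleVW n 1`.  The operators
`Rl k` act on the 0-based positions `k, k+1`, so the chain `R_{m−1}⋯R_1` is
`opChain Rl (m−1)`, the identity when `m = 1`.  Mathlib's inner product is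
conjugate-linear in the first variable, so the paper's `⟨A Ξ, Ξ⟩` is `inner Ξ (A Ξ)`.)
-/

theorem thoma_character_value_at_q_one (n : ℕ)
    (α β : ℕ → ℝ) (hα : ∀ j, 0 ≤ α j) (hβ : ∀ i, 0 ≤ β i)
    (hαs : Summable α) (hβs : Summable β)
    (hab : ∑' j, α j + ∑' i, β i = 1)
    (Rl : ℕ → (HVW n →L[ℂ] HVW n))
    (hR : ∀ k (hk : k + 1 < n), KerovRuleVW n 1 k hk (Rl k))
    (m : ℕ) (hm : 1 ≤ m) (hmn : m ≤ n) :
    (inner ℂ (Xi n (aOf α β)) (opChain Rl (m - 1) (Xi n (aOf α β))) : ℂ)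
      = (((∑' j, α j ^ m) + (-1 : ℝ) ^ (m - 1) * ∑' i, β i ^ m : ℝ) : ℂ) := by
  obtain ⟨j, rfl⟩ : ∃ j, m = j + 1 := ⟨m - 1, by omega⟩
  obtain ⟨r, rfl⟩ : ∃ r, n = j + 1 + r := ⟨n - (j + 1), by omega⟩
  have ha : ∀ i, 0 ≤ aOf α β i := fun i => by
    unfold aOf
    split_ifs
    exacts [hα _, hβ _]
  have hs : HasSum (aOf α β) 1 := by
    rw [← natSumNatEquivSz.hasSum_iff, ← hab]
    refine HasSum.sum ?_ ?_
    · simpa [Function.comp_def, aOf_inl] using hαs.hasSum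
    · simpa [Function.comp_def, aOf_inr] using hβs.hasSum
  have hα1 : ∑' i, α i ≤ 1 := by linarith [(tsum_nonneg hβ : 0 ≤ ∑' i, β i)]
  have hβ1 : ∑' i, β i ≤ 1 := by linarith [(tsum_nonneg hα : 0 ≤ ∑' i, α i)]
  have hpow : HasSum (fun i => kerovSign i i ^ j * aOf α β i ^ (j + 1))
      ((∑' i, α i ^ (j + 1)) + (-1) ^ j * ∑' i, β i ^ (j + 1)) := by
    rw [← natSumNatEquivSz.hasSum_iff]
    refine HasSum.sum ?_ ?_
    · simpa [Function.comp_def, aOf_inl, kerovSign_inl] using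
        (summable_pow_of_tsum_le_one hα hαs hα1 j).hasSum
    · simpa [Function.comp_def, aOf_inr, kerovSign_inr] using
        (summable_pow_of_tsum_le_one hβ hβs hβ1 j).hasSum.mul_left ((-1) ^ j)
  exact (inner_xi_opChain_hasSum ha hs hR j (by omega)).unique
    (Complex.hasSum_ofReal.2 (hasSum_cycleTuple_fixed hs j r hpow))
end
end
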